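/- arXiv:1412.4027 — 2 statements merged into one kernel-verified Lean document; each statement's English description precedes it below -/
import Mathlib

section
/- (Serre; Theorem 3.1 of the paper) Let K/k be a finite Galois extension with Galois group G, V a finite-dimensional k-vector space and x ∈ V^{⊗p} ⊗_k (V^*)^{⊗q} a tensor of type (p,q). Let A_K be the group of K-linear automorphisms f of V_K whose induced action on (V_K)^{⊗p} ⊗_K (V_K^*)^{⊗q} fixes x_K, with G acting on A_K by f ↦ s(f) = s ∘ f ∘ s⁻¹. Let E_{V,x}(K/k) be the set of k-isomorphism classes of pairs (V', x') (V' a finite-dimensional k-vector space, x' ∈ V'^{⊗p} ⊗_k (V'^*)^{⊗q}) that become isomorphic to (V,x) over K. Then the map θ : E_{V,x}(K/k) → H¹(G, A_K), sending the class of (V',x') to the cohomology class of the 1-cocycle s ↦ f⁻¹ ∘ s(f), where f : V_K → V'_K is any K-linear isomorphism carrying x_K to x'_K, is well defined and bijective. -/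
open TensorProduct

noncomputable section

universe u

/-! ### Tensor spaces of type `(p, q)` -/

section TensorSpace

variable (F : Type u) [Field F] (W : Type u) [AddCommGroup W] [Module F W] (p q : ℕ)

/-- The `i`-th factor of the tensor space `W^{⊗p} ⊗ (W^*)^{⊗q}`. -/
def TensorFactor : Fin p ⊕ Fin q → Type u := fun i =>
  match i with
  | Sum.inl _ => W
  | Sum.inr _ => Module.Dual F W

instance (i : Fin p ⊕ Fin q) : AddCommGroup (TensorFactor F W p q i) :=
  match i with
  | Sum.inl _ => inferInstanceAs (AddCommGroup W)
  | Sum.inr _ => inferInstanceAs (AddCommGroup (Module.Dual F W))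

instance (i : Fin p ⊕ Fin q) : Module F (TensorFactor F W p q i) :=
  match i with
  | Sum.inl _ => inferInstanceAs (Module F W)
  | Sum.inr _ => inferInstanceAs (Module F (Module.Dual F W))

/-- The space of tensors of type `(p, q)` on `W`: `W^{⊗p} ⊗ (W^*)^{⊗q}`. -/
def TensorSpace : Type u := ⨂[F] i : Fin p ⊕ Fin q, TensorFactor F W p q i

instance : AddCommGroup (TensorSpace F W p q) :=
  inferInstanceAs (AddCommGroup (⨂[F] i : Fin p ⊕ Fin q, TensorFactor F W p q i))

instance : Module F (TensorSpace F W p q) :=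
  inferInstanceAs (Module F (⨂[F] i : Fin p ⊕ Fin q, TensorFactor F W p q i))

variable {F p q}

/-- The equivalence of tensor spaces of type `(p, q)` induced by a linear
equivalence `e : W ≃ W'` (acting by `e` on each factor `W` and by the
contragredient of `e` on each factor `W^*`). -/
def tensorCongr {W W' : Type u} [AddCommGroup W] [Module F W]
    [AddCommGroup W'] [Module F W']
    (e : W ≃ₗ[F] W') : TensorSpace F W p q ≃ₗ[F] TensorSpace F W' p q :=
  PiTensorProduct.congr fun i =>
    match i with
    | Sum.inl _ => e
    | Sum.inr _ => e.symm.dualMap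

end TensorSpace

/-! ### Base change of tensors -/

section BaseChange

variable (k K : Type u) [Field k] [Field K] [Algebra k K]
variable (V : Type u) [AddCommGroup V] [Module k V] (p q : ℕ)

/-- The canonical map `V → K ⊗[k] V`, `v ↦ 1 ⊗ v`. -/
def inclBC : V →ₗ[k] K ⊗[k] V := TensorProduct.mk k K V 1

/-- Base change of linear functionals: `f : V → k` extends to
`f_K : K ⊗[k] V → K`. -/
def dualBC : Module.Dual k V →ₗ[k] Module.Dual K (K ⊗[k] V) :=
  (((LinearMap.liftBaseChangeEquiv K).toLinearMap).restrictScalars k) ∘ₗ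
    (LinearMap.llcomp k V k K (Algebra.linearMap k K))

instance (i : Fin p ⊕ Fin q) : Module k (TensorFactor K (K ⊗[k] V) p q i) :=
  match i with
  | Sum.inl _ => inferInstanceAs (Module k (K ⊗[k] V))
  | Sum.inr _ => inferInstanceAs (Module k (Module.Dual K (K ⊗[k] V)))

instance (i : Fin p ⊕ Fin q) : IsScalarTower k K (TensorFactor K (K ⊗[k] V) p q i) :=
  match i with
  | Sum.inl _ => inferInstanceAs (IsScalarTower k K (K ⊗[k] V))
  | Sum.inr _ => inferInstanceAs (IsScalarTower k K (Module.Dual K (K ⊗[k] V)))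

instance : Module k (TensorSpace K (K ⊗[k] V) p q) :=
  inferInstanceAs (Module k (⨂[K] i : Fin p ⊕ Fin q, TensorFactor K (K ⊗[k] V) p q i))

/-- Base change on each factor of a tensor space. -/
def factorBC : ∀ i : Fin p ⊕ Fin q,
    TensorFactor k V p q i →ₗ[k] TensorFactor K (K ⊗[k] V) p q i := fun i =>
  match i with
  | Sum.inl _ => inclBC k K V
  | Sum.inr _ => dualBC k K V

/-- Base change of tensors of type `(p, q)`: the canonical map
`V^{⊗p} ⊗ (V^*)^{⊗q} → (V_K)^{⊗p} ⊗_K (V_K^*)^{⊗q}`, `x ↦ x_K`. -/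
def tensorBC : TensorSpace k V p q →ₗ[k] TensorSpace K (K ⊗[k] V) p q :=
  PiTensorProduct.lift
    (((PiTensorProduct.tprod K).restrictScalars k).compLinearMap (factorBC k K V p q))

end BaseChange

/-! ### The semilinear Galois action and conjugation -/

section GaloisConjugation

variable {k K : Type u} [Field k] [Field K] [Algebra k K]
variable {V W : Type u} [AddCommGroup V] [Module k V] [AddCommGroup W] [Module k W]

/-- The semilinear Galois action on the base change `K ⊗[k] V`, as a
`k`-linear equivalence: `s (λ ⊗ v) = s λ ⊗ v`. -/
def galAct (s : K ≃ₐ[k] K) : K ⊗[k] V ≃ₗ[k] K ⊗[k] V :=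
  TensorProduct.congr s.toLinearEquiv (LinearEquiv.refl k V)

lemma galAct_tmul (s : K ≃ₐ[k] K) (a : K) (v : V) :
    galAct s (a ⊗ₜ[k] v) = s a ⊗ₜ[k] v := rfl

lemma galAct_smul (s : K ≃ₐ[k] K) (c : K) (x : K ⊗[k] V) :
    galAct s (c • x) = s c • galAct s x := by
  induction x using TensorProduct.induction_on with
  | zero => simp
  | tmul a v =>
      rw [TensorProduct.smul_tmul', galAct_tmul, galAct_tmul, TensorProduct.smul_tmul',
        smul_eq_mul, smul_eq_mul, map_mul]
  | add x y hx hy => simp [smul_add, map_add, hx, hy]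

lemma galAct_galAct (s : K ≃ₐ[k] K) (x : K ⊗[k] V) :
    galAct s (galAct s.symm x) = x := by
  induction x using TensorProduct.induction_on with
  | zero => simp
  | tmul a v => rw [galAct_tmul, galAct_tmul]; simp
  | add x y hx hy => simp [map_add, hx, hy]

lemma galAct_galAct' (s : K ≃ₐ[k] K) (x : K ⊗[k] V) :
    galAct s.symm (galAct s x) = x := by
  conv_rhs => rw [← galAct_galAct s.symm x]
  simp

/-- Conjugation `f ↦ s(f) = s ∘ f ∘ s⁻¹` of a `K`-linear map between base
changes by the semilinear Galois action. -/
def galConjMap (s : K ≃ₐ[k] K) (f : (K ⊗[k] V) →ₗ[K] (K ⊗[k] W)) :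
    (K ⊗[k] V) →ₗ[K] (K ⊗[k] W) where
  toFun x := galAct s (f (galAct s.symm x))
  map_add' x y := by simp
  map_smul' c x := by
    simp only [RingHom.id_apply]
    rw [galAct_smul s.symm, map_smul, galAct_smul s]
    simp

/-- Conjugation `f ↦ s(f) = s ∘ f ∘ s⁻¹` of a `K`-linear equivalence between
base changes by the semilinear Galois action. -/
def galConj (s : K ≃ₐ[k] K) (f : (K ⊗[k] V) ≃ₗ[K] (K ⊗[k] W)) :
    (K ⊗[k] V) ≃ₗ[K] (K ⊗[k] W) :=
  { galConjMap s f.toLinearMap with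
    invFun := fun y => galAct s (f.symm (galAct s.symm y))
    left_inv := fun x => by
      simp [galConjMap, galAct_galAct', galAct_galAct]
    right_inv := fun y => by
      simp [galConjMap, galAct_galAct', galAct_galAct] }

end GaloisConjugation

/-! ### The statement -/

section Statement

variable (k K : Type u) [Field k] [Field K] [Algebra k K] [IsGalois k K]
  [FiniteDimensional k K]

/-- A finite-dimensional `k`-vector space equipped with a tensor of type
`(p, q)`. -/
structure TensorPair (k : Type u) [Field k] (p q : ℕ) : Type (u + 1) where
  carrier : Type u
  [acg : AddCommGroup carrier]
  [mod : Module k carrier]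
  [fd : FiniteDimensional k carrier]
  tensor : TensorSpace k carrier p q

attribute [instance] TensorPair.acg TensorPair.mod TensorPair.fd

variable {V : Type u} [AddCommGroup V] [Module k V] [FiniteDimensional k V]
variable {p q : ℕ}

variable (V p q) in
/-- `f : V_K ≃ V'_K` is a `K`-isomorphism from `(V, x)` to `(V', x')`,
i.e. it carries `x_K` to `x'_K`. -/
def IsTensorIsoK (x : TensorSpace k V p q) (P : TensorPair k p q)
    (f : (K ⊗[k] V) ≃ₗ[K] (K ⊗[k] P.carrier)) : Prop :=
  tensorCongr f (tensorBC k K V p q x) = tensorBC k K P.carrier p q P.tensor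

variable (V p q) in
/-- The pair `(V', x')` becomes isomorphic to `(V, x)` over `K`. -/
def BecomesIsomorphic (x : TensorSpace k V p q) (P : TensorPair k p q) : Prop :=
  ∃ f : (K ⊗[k] V) ≃ₗ[K] (K ⊗[k] P.carrier), IsTensorIsoK k K V p q x P f

/-- `k`-isomorphism of pairs `(V', x')`. -/
def kIsomorphic (P P' : TensorPair k p q) : Prop :=
  ∃ e : P.carrier ≃ₗ[k] P'.carrier, tensorCongr e P.tensor = P'.tensor

variable (V p q) in
/-- The set `E_{V,x}(K/k)` of `k`-isomorphism classes of pairs `(V', x')`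
that become isomorphic to `(V, x)` over `K`. -/
def TensorClasses (x : TensorSpace k V p q) : Type (u + 1) :=
  Quot (fun P P' : {P : TensorPair k p q // BecomesIsomorphic k K V p q x P} =>
    kIsomorphic k P.1 P'.1)

variable (V p q) in
/-- The conditions defining a 1-cocycle of `G = Gal(K/k)` in the group `A_K`
of `K`-automorphisms of `V_K` fixing `x_K` (this group being unfolded as a
subgroup of the `K`-linear automorphism group of `V_K`), for the conjugation
action `f ↦ s(f) = s ∘ f ∘ s⁻¹`. -/
def IsTensorCocycle (x : TensorSpace k V p q)
    (a : (K ≃ₐ[k] K) → ((K ⊗[k] V) ≃ₗ[K] (K ⊗[k] V))) : Prop :=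
  (∀ s : K ≃ₐ[k] K, tensorCongr (a s) (tensorBC k K V p q x) = tensorBC k K V p q x) ∧
    ∀ s t : K ≃ₐ[k] K, a (s * t) = a s * galConj s (a t)

variable (V p q) in
/-- Two 1-cocycles in `A_K` are cohomologous. -/
def TensorCohomologous (x : TensorSpace k V p q)
    (a b : (K ≃ₐ[k] K) → ((K ⊗[k] V) ≃ₗ[K] (K ⊗[k] V))) : Prop :=
  ∃ c : (K ⊗[k] V) ≃ₗ[K] (K ⊗[k] V),
    tensorCongr c (tensorBC k K V p q x) = tensorBC k K V p q x ∧
    ∀ s : K ≃ₐ[k] K, b s = c⁻¹ * a s * galConj s c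

variable (V p q) in
/-- The nonabelian cohomology set `H¹(Gal(K/k), A_K)`. -/
def TensorH1 (x : TensorSpace k V p q) : Type u :=
  Quot (fun a b : {a : (K ≃ₐ[k] K) → ((K ⊗[k] V) ≃ₗ[K] (K ⊗[k] V)) //
    IsTensorCocycle k K V p q x a} => TensorCohomologous k K V p q x a.1 b.1)

end Statement

section HelpersA

variable {k K : Type u} [Field k] [Field K] [Algebra k K]
variable {V W X : Type u} [AddCommGroup V] [Module k V] [AddCommGroup W] [Module k W]
  [AddCommGroup X] [Module k X]

lemma galConj_apply (s : K ≃ₐ[k] K) (f : (K ⊗[k] V) ≃ₗ[K] (K ⊗[k] W)) (y : K ⊗[k] V) :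
    galConj s f y = galAct s (f (galAct s.symm y)) := rfl

lemma galAct_mul (s t : K ≃ₐ[k] K) (y : K ⊗[k] V) :
    galAct (s * t) y = galAct s (galAct t y) := by
  induction y using TensorProduct.induction_on with
  | zero => simp
  | tmul a v => rfl
  | add x y hx hy => simp [map_add, hx, hy]

lemma galConj_galAct (s : K ≃ₐ[k] K) (f : (K ⊗[k] V) ≃ₗ[K] (K ⊗[k] W)) (y : K ⊗[k] V) :
    galConj s f (galAct s y) = galAct s (f y) := by
  rw [galConj_apply, galAct_galAct']

lemma galConj_trans (s : K ≃ₐ[k] K) (f : (K ⊗[k] V) ≃ₗ[K] (K ⊗[k] W))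
    (g : (K ⊗[k] W) ≃ₗ[K] (K ⊗[k] X)) :
    galConj s (f.trans g) = (galConj s f).trans (galConj s g) := by
  ext1 y
  simp [galConj_apply, galAct_galAct']

lemma galConj_symm (s : K ≃ₐ[k] K) (f : (K ⊗[k] V) ≃ₗ[K] (K ⊗[k] W)) :
    galConj s f.symm = (galConj s f).symm := rfl

lemma galConj_mul (s t : K ≃ₐ[k] K) (f : (K ⊗[k] V) ≃ₗ[K] (K ⊗[k] W)) :
    galConj (s * t) f = galConj s (galConj t f) := by
  ext1 y
  obtain ⟨z, rfl⟩ := (galAct (s * t)).surjective y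
  rw [galConj_galAct, galAct_mul, galAct_mul, galConj_galAct, galConj_galAct]

/-- base change of a `k`-linear equivalence. -/
def eqBC (K : Type u) [Field K] [Algebra k K] (e : V ≃ₗ[k] W) : (K ⊗[k] V) ≃ₗ[K] (K ⊗[k] W) :=
  e.baseChange k K V W

lemma eqBC_tmul (e : V ≃ₗ[k] W) (a : K) (v : V) : eqBC K e (a ⊗ₜ v) = a ⊗ₜ e v := rfl

lemma galConj_eqBC (s : K ≃ₐ[k] K) (e : V ≃ₗ[k] W) : galConj s (eqBC K e) = eqBC K e := by
  ext1 y
  obtain ⟨z, rfl⟩ := (galAct s).surjective y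
  rw [galConj_galAct]
  induction z using TensorProduct.induction_on with
  | zero => simp
  | tmul a v => rfl
  | add x y hx hy => simp only [map_add, hx, hy]

lemma inclBC_injective : Function.Injective (inclBC k K V) := by
  intro v w h
  exact Module.FaithfullyFlat.tensorProduct_mk_injective (A := k) (B := K) V h

lemma exists_of_fixed [IsGalois k K] [FiniteDimensional k K] (y : K ⊗[k] V)
    (h : ∀ s : K ≃ₐ[k] K, galAct s y = y) : ∃ v : V, y = 1 ⊗ₜ v := by
  let b := Module.Basis.ofVectorSpace k V
  let B := b.baseChange K
  have hr : ∀ (s : K ≃ₐ[k] K) (z : K ⊗[k] V) i, B.repr (galAct s z) i = s (B.repr z i) := by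
    intro s z i
    induction z using TensorProduct.induction_on with
    | zero => simp
    | tmul a v => simp [galAct_tmul, B]
    | add x y hx hy => simp [map_add, hx, hy]
  have hc : ∀ i, ∃ c : k, algebraMap k K c = B.repr y i := by
    intro i
    have := (IsGalois.mem_range_algebraMap_iff_fixed (F := k) (B.repr y i)).2
      (fun s => by rw [← hr, h])
    simpa using this
  choose c hc using hc
  refine ⟨(B.repr y).sum fun i _ => c i • b i, ?_⟩
  conv_lhs => rw [← B.linearCombination_repr y]
  rw [Finsupp.linearCombination_apply, Finsupp.sum, Finsupp.sum, TensorProduct.tmul_sum]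
  refine Finset.sum_congr rfl fun i _ => ?_
  rw [← hc, Module.Basis.baseChange_apply, TensorProduct.smul_tmul', TensorProduct.tmul_smul,
    TensorProduct.smul_tmul', smul_eq_mul, Algebra.smul_def (c i)]

lemma exists_linearMap_of_fixed [IsGalois k K] [FiniteDimensional k K]
    (h : (K ⊗[k] V) ≃ₗ[K] (K ⊗[k] W)) (hh : ∀ s : K ≃ₐ[k] K, galConj s h = h) :
    ∀ v : V, ∃ w : W, h (1 ⊗ₜ v) = 1 ⊗ₜ w := by
  intro v
  apply exists_of_fixed
  intro s
  rw [← galConj_galAct, hh, galAct_tmul, map_one]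

lemma exists_eqBC_of_fixed [IsGalois k K] [FiniteDimensional k K]
    (h : (K ⊗[k] V) ≃ₗ[K] (K ⊗[k] W)) (hh : ∀ s : K ≃ₐ[k] K, galConj s h = h) :
    ∃ e : V ≃ₗ[k] W, eqBC K e = h := by
  have h' : ∀ s : K ≃ₐ[k] K, galConj s h.symm = h.symm := by
    intro s; rw [galConj_symm, hh]
  choose e he using exists_linearMap_of_fixed h hh
  choose e' he' using exists_linearMap_of_fixed h.symm h'
  have hi := inclBC_injective (k := k) (K := K) (V := V)
  have hi' := inclBC_injective (k := k) (K := K) (V := W)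
  refine ⟨{ toFun := e, invFun := e', map_add' := ?_, map_smul' := ?_,
            left_inv := ?_, right_inv := ?_ }, ?_⟩
  · intro x y
    apply hi'
    change (1 : K) ⊗ₜ[k] _ = (1 : K) ⊗ₜ[k] _
    rw [← he, TensorProduct.tmul_add, TensorProduct.tmul_add, map_add, he, he]
  · intro c x
    apply hi'
    change (1 : K) ⊗ₜ[k] _ = (1 : K) ⊗ₜ[k] _
    rw [← he, RingHom.id_apply, TensorProduct.tmul_smul, TensorProduct.tmul_smul, ← he,
      ← algebraMap_smul K c, map_smul, algebraMap_smul]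
  · intro x
    apply hi
    change (1 : K) ⊗ₜ[k] _ = (1 : K) ⊗ₜ[k] _
    rw [← he', ← he, LinearEquiv.symm_apply_apply]
  · intro x
    apply hi'
    change (1 : K) ⊗ₜ[k] _ = (1 : K) ⊗ₜ[k] _
    rw [← he, ← he', LinearEquiv.apply_symm_apply]
  · ext1 y
    induction y using TensorProduct.induction_on with
    | zero => simp
    | tmul a v =>
      have : a ⊗ₜ[k] v = a • ((1 : K) ⊗ₜ[k] v) := by
        rw [TensorProduct.smul_tmul', smul_eq_mul, mul_one]
      rw [eqBC_tmul, this, map_smul, he, TensorProduct.smul_tmul', smul_eq_mul, mul_one]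
      rfl
    | add x y hx hy => simp only [map_add, hx, hy]

end HelpersA

section HelpersB

variable {k K : Type u} [Field k] [Field K] [Algebra k K] [IsGalois k K] [FiniteDimensional k K]
variable {V : Type u} [AddCommGroup V] [Module k V]

/-- The descended space of a cocycle. -/
def descSpace (a : (K ≃ₐ[k] K) → ((K ⊗[k] V) ≃ₗ[K] (K ⊗[k] V))) : Submodule k (K ⊗[k] V) where
  carrier := {v | ∀ s, a s (galAct s v) = v}
  add_mem' := by
    intro x y hx hy s
    rw [map_add, map_add, hx, hy]
  zero_mem' := by intro s; simp
  smul_mem' := by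
    intro c x hx s
    rw [map_smul, ← algebraMap_smul K c, map_smul, hx, algebraMap_smul]

/-- The descended space as a type. -/
def DescT (a : (K ≃ₐ[k] K) → ((K ⊗[k] V) ≃ₗ[K] (K ⊗[k] V))) : Type u := descSpace a

instance descTAddCommGroup (a : (K ≃ₐ[k] K) → ((K ⊗[k] V) ≃ₗ[K] (K ⊗[k] V))) :
    AddCommGroup (DescT a) := inferInstanceAs (AddCommGroup (descSpace a))

instance descTModule (a : (K ≃ₐ[k] K) → ((K ⊗[k] V) ≃ₗ[K] (K ⊗[k] V))) :
    Module k (DescT a) := inferInstanceAs (Module k (descSpace a))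

/-- The inclusion of the descended space. -/
def descIncl (a : (K ≃ₐ[k] K) → ((K ⊗[k] V) ≃ₗ[K] (K ⊗[k] V))) : DescT a →ₗ[k] (K ⊗[k] V) :=
  (descSpace a).subtype

lemma descIncl_mem (a : (K ≃ₐ[k] K) → ((K ⊗[k] V) ≃ₗ[K] (K ⊗[k] V))) (w : DescT a)
    (s : K ≃ₐ[k] K) : a s (galAct s (descIncl a w)) = descIncl a w := w.2 s

lemma descIncl_injective (a : (K ≃ₐ[k] K) → ((K ⊗[k] V) ≃ₗ[K] (K ⊗[k] V))) :
    Function.Injective (descIncl a) := Subtype.val_injective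

/-- The comparison map. -/
def descMap (a : (K ≃ₐ[k] K) → ((K ⊗[k] V) ≃ₗ[K] (K ⊗[k] V))) :
    (K ⊗[k] DescT a) →ₗ[K] (K ⊗[k] V) :=
  LinearMap.liftBaseChange K (descIncl a)

lemma descMap_tmul (a : (K ≃ₐ[k] K) → ((K ⊗[k] V) ≃ₗ[K] (K ⊗[k] V))) (c : K) (w : DescT a) :
    descMap a (c ⊗ₜ w) = c • descIncl a w := by
  simp [descMap]

lemma descMap_equivariant (a : (K ≃ₐ[k] K) → ((K ⊗[k] V) ≃ₗ[K] (K ⊗[k] V)))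
    (s : K ≃ₐ[k] K) (y : K ⊗[k] DescT a) :
    a s (galAct s (descMap a y)) = descMap a (galAct s y) := by
  induction y using TensorProduct.induction_on with
  | zero => simp
  | tmul c w =>
    rw [galAct_tmul, descMap_tmul, descMap_tmul, galAct_smul, map_smul, descIncl_mem]
  | add x y hx hy => simp only [map_add, hx, hy]

lemma descMap_injective (a : (K ≃ₐ[k] K) → ((K ⊗[k] V) ≃ₗ[K] (K ⊗[k] V))) :
    Function.Injective (descMap a) := by
  classical
  rw [injective_iff_map_eq_zero]
  intro y hy
  let b := Module.finBasis k K
  let n := Module.finrank k K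
  have hnd : (Algebra.traceForm k K).Nondegenerate := traceForm_nondegenerate k K
  let d := (Algebra.traceForm k K).dualBasis hnd b
  have hex : ∀ y : K ⊗[k] DescT a, ∃ w : Fin n → DescT a, y = ∑ i, b i ⊗ₜ[k] w i := by
    intro y
    induction y using TensorProduct.induction_on with
    | zero => exact ⟨0, by simp⟩
    | tmul c v =>
      refine ⟨fun i => b.repr c i • v, ?_⟩
      conv_lhs => rw [← b.sum_repr c]
      rw [TensorProduct.sum_tmul]
      simp only [TensorProduct.smul_tmul]
    | add x y hx hy =>
      obtain ⟨w, rfl⟩ := hx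
      obtain ⟨w', rfl⟩ := hy
      exact ⟨w + w', by simp [TensorProduct.tmul_add, Finset.sum_add_distrib]⟩
  obtain ⟨w, rfl⟩ := hex y
  have h1 : ∀ s : K ≃ₐ[k] K, ∑ i, s (b i) • descIncl a (w i) = 0 := by
    intro s
    have := descMap_equivariant a s (∑ i, b i ⊗ₜ[k] w i)
    rw [hy] at this
    simpa [galAct_tmul, descMap_tmul] using this.symm
  have h2 : ∀ c : K, ∑ i, (Algebra.trace k K (c * b i)) • descIncl a (w i) = 0 := by
    intro c
    have : ∑ s : K ≃ₐ[k] K, s c • ∑ i, s (b i) • descIncl a (w i) = 0 := by simp [h1]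
    rw [← this]
    simp only [Finset.smul_sum]
    rw [Finset.sum_comm]
    refine Finset.sum_congr rfl fun i _ => ?_
    rw [← algebraMap_smul K (Algebra.trace k K (c * b i)), trace_eq_sum_automorphisms,
      Finset.sum_smul]
    simp [smul_smul]
  have h3 : ∀ j, w j = 0 := by
    intro j
    have := h2 (d j)
    have hd : ∀ i, Algebra.trace k K (d j * b i) = if i = j then 1 else 0 := by
      intro i
      exact LinearMap.BilinForm.apply_dualBasis_left hnd b j i
    simp only [hd, ite_smul, one_smul, zero_smul, Finset.sum_ite_eq', Finset.mem_univ,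
      if_true] at this
    exact descIncl_injective a (this.trans (map_zero _).symm)
  simp [h3]

lemma descMap_surjective (a : (K ≃ₐ[k] K) → ((K ⊗[k] V) ≃ₗ[K] (K ⊗[k] V)))
    (ha : ∀ s t : K ≃ₐ[k] K, a (s * t) = a s * galConj s (a t)) :
    Function.Surjective (descMap a) := by
  classical
  have ha1 : ∀ v, a 1 v = v := by
    intro v
    have h := ha 1 1
    have h2 : galConj (1 : K ≃ₐ[k] K) (a 1) = a 1 := by
      ext1 y
      have h1 : ∀ z : K ⊗[k] V, galAct (1 : K ≃ₐ[k] K) z = z := by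
        intro z
        induction z using TensorProduct.induction_on with
        | zero => simp
        | tmul a v => rfl
        | add x y hx hy => simp only [map_add, hx, hy]
      conv_lhs => rw [← h1 y]
      rw [galConj_galAct, h1]
    rw [mul_one, h2] at h
    have : a 1 = 1 := by simpa using h
    rw [this]; rfl
  have hmem : ∀ (c : K) (v : K ⊗[k] V),
      ∑ s : K ≃ₐ[k] K, s c • a s (galAct s v) ∈ descSpace a := by
    intro c v t
    simp only [map_sum, galAct_smul, map_smul]
    refine Fintype.sum_equiv (Equiv.mulLeft t) _ _ fun s => ?_
    rw [Equiv.coe_mulLeft, ha t s, galAct_mul, LinearEquiv.mul_apply, galConj_galAct]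
    rfl
  rw [← LinearMap.range_eq_top]
  by_contra hne
  obtain ⟨φ, hφ, hle⟩ := Submodule.exists_le_ker_of_lt_top _ (lt_top_iff_ne_top.2 hne)
  apply hφ
  apply LinearMap.ext
  intro v
  have hz : ∀ c : K, ∑ s : K ≃ₐ[k] K, s c * φ (a s (galAct s v)) = 0 := by
    intro c
    have := hle (x := ∑ s : K ≃ₐ[k] K, s c • a s (galAct s v))
      ⟨1 ⊗ₜ (⟨_, hmem c v⟩ : descSpace a), by
        refine (descMap_tmul a 1 (⟨_, hmem c v⟩ : descSpace a)).trans ?_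
        rw [one_smul]; rfl⟩
    simpa using this
  have hli := linearIndependent_monoidHom K K
  have hli2 := hli.comp (fun s : K ≃ₐ[k] K => (s : K →* K)) (by
    intro s t h
    ext x
    exact DFunLike.congr_fun h x)
  rw [Fintype.linearIndependent_iff] at hli2
  have := hli2 (fun s => φ (a s (galAct s v))) (by
    ext c
    have := hz c
    simpa [mul_comm] using this) 1
  have h1 : galAct (1 : K ≃ₐ[k] K) v = v := by
    apply (galAct (1 : K ≃ₐ[k] K)).injective
    rw [← galAct_mul, one_mul]
  simpa [h1, ha1] using this

end HelpersB

section HelpersC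

section general
variable {F : Type u} [Field F] {p q : ℕ}
variable {W W' W'' : Type u} [AddCommGroup W] [Module F W] [AddCommGroup W'] [Module F W']
  [AddCommGroup W''] [Module F W'']

/-- pure tensors -/
def tprodT (F : Type u) [Field F] (W : Type u) [AddCommGroup W] [Module F W] (p q : ℕ) :
    MultilinearMap F (TensorFactor F W p q) (TensorSpace F W p q) := PiTensorProduct.tprod F

/-- action of an equivalence on factors -/
def factorCongr (e : W ≃ₗ[F] W') : ∀ i : Fin p ⊕ Fin q,
    TensorFactor F W p q i ≃ₗ[F] TensorFactor F W' p q i := fun i =>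
  match i with
  | Sum.inl _ => e
  | Sum.inr _ => e.symm.dualMap

lemma tensor_induction {C : TensorSpace F W p q → Prop}
    (h1 : ∀ (r : F) (m : ∀ i, TensorFactor F W p q i), C (r • tprodT F W p q m))
    (h2 : ∀ x y, C x → C y → C (x + y)) (z : TensorSpace F W p q) : C z :=
  PiTensorProduct.induction_on (motive := C) z (fun {r m} => h1 r m) (fun {x y} hx hy => h2 x y hx hy)

lemma tensorCongr_tprod (e : W ≃ₗ[F] W') (m : ∀ i, TensorFactor F W p q i) :
    tensorCongr e (tprodT F W p q m) = tprodT F W' p q (fun i => factorCongr e i (m i)) := by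
  refine (PiTensorProduct.congr_tprod (R := F) _ m).trans ?_
  refine congrArg (tprodT F W' p q) ?_
  funext i
  rcases i with i | i <;> rfl

lemma tensorCongr_trans (e : W ≃ₗ[F] W') (f : W' ≃ₗ[F] W'') (y : TensorSpace F W p q) :
    tensorCongr (e.trans f) y = tensorCongr f (tensorCongr e y) := by
  induction y using tensor_induction with
  | h1 r m =>
    simp only [map_smul, tensorCongr_tprod]
    congr 2
    funext i
    rcases i with i | i <;> rfl
  | h2 x y hx hy => simp only [map_add, hx, hy]

lemma tensorCongr_refl (y : TensorSpace F W p q) :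
    tensorCongr (LinearEquiv.refl F W) y = y := by
  induction y using tensor_induction with
  | h1 r m =>
    simp only [map_smul, tensorCongr_tprod]
    congr 2
    funext i
    rcases i with i | i <;> rfl
  | h2 x y hx hy => simp only [map_add, hx, hy]

lemma tensorCongr_symm (e : W ≃ₗ[F] W') (y : TensorSpace F W p q) (z : TensorSpace F W' p q)
    (h : tensorCongr e y = z) : tensorCongr e.symm z = y := by
  rw [← h, ← tensorCongr_trans, LinearEquiv.self_trans_symm, tensorCongr_refl]

end general

variable {k K : Type u} [Field k] [Field K] [Algebra k K]
variable {V W : Type u} [AddCommGroup V] [Module k V] [AddCommGroup W] [Module k W] {p q : ℕ}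

instance tensorSpaceTower : IsScalarTower k K (TensorSpace K (K ⊗[k] V) p q) :=
  inferInstanceAs (IsScalarTower k K (⨂[K] i : Fin p ⊕ Fin q, TensorFactor K (K ⊗[k] V) p q i))

lemma tensorBC_tprod (m : ∀ i, TensorFactor k V p q i) :
    tensorBC k K V p q (tprodT k V p q m) =
      tprodT K (K ⊗[k] V) p q (fun i => factorBC k K V p q i (m i)) :=
  PiTensorProduct.lift.tprod (R := k) m

lemma dualBC_tmul (φ : Module.Dual k V) (a : K) (v : V) :
    dualBC k K V φ (a ⊗ₜ v) = a * algebraMap k K (φ v) := by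
  simp [dualBC]

lemma dual_ext' {φ ψ : Module.Dual K (K ⊗[k] V)}
    (h : ∀ (a : K) (v : V), φ (a ⊗ₜ v) = ψ (a ⊗ₜ v)) : φ = ψ := by
  apply LinearMap.ext
  intro y
  induction y using TensorProduct.induction_on with
  | zero => simp
  | tmul a v => exact h a v
  | add x y hx hy => simp only [map_add, hx, hy]

lemma factorBC_congr (e : V ≃ₗ[k] W) (i : Fin p ⊕ Fin q) (m : TensorFactor k V p q i) :
    factorCongr (eqBC K e) i (factorBC k K V p q i m) =
      factorBC k K W p q i (factorCongr e i m) := by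
  rcases i with i | i
  · rfl
  · refine dual_ext' (V := W) fun a v => ?_
    refine (dualBC_tmul (V := V) m a (e.symm v)).trans ?_
    exact (dualBC_tmul (V := W) (e.symm.dualMap m) a v).symm

lemma tensorBC_congr (e : V ≃ₗ[k] W) (y : TensorSpace k V p q) :
    tensorCongr (eqBC K e) (tensorBC k K V p q y) = tensorBC k K W p q (tensorCongr e y) := by
  induction y using tensor_induction with
  | h1 r m =>
    rw [map_smul (tensorBC k K V p q), map_smul (tensorCongr e), map_smul (tensorBC k K W p q),
      ← algebraMap_smul K r, ← algebraMap_smul K r, map_smul (tensorCongr (eqBC K e)),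
      tensorBC_tprod, tensorCongr_tprod, tensorCongr_tprod, tensorBC_tprod]
    simp only [factorBC_congr]
  | h2 x y hx hy => simp only [map_add, hx, hy]

/-- Galois action on the dual. -/
def dualGal (s : K ≃ₐ[k] K) (φ : Module.Dual K (K ⊗[k] V)) : Module.Dual K (K ⊗[k] V) where
  toFun y := s (φ (galAct s.symm y))
  map_add' x y := by simp
  map_smul' c x := by simp [galAct_smul]

/-- Galois action on the factors. -/
def factorGal (s : K ≃ₐ[k] K) : ∀ i : Fin p ⊕ Fin q,
    TensorFactor K (K ⊗[k] V) p q i → TensorFactor K (K ⊗[k] V) p q i := fun i =>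
  match i with
  | Sum.inl _ => fun v => galAct (V := V) s v
  | Sum.inr _ => fun φ => dualGal (V := V) s φ

lemma factorGal_add (s : K ≃ₐ[k] K) (i : Fin p ⊕ Fin q) (x y : TensorFactor K (K ⊗[k] V) p q i) :
    factorGal s i (x + y) = factorGal s i x + factorGal s i y := by
  rcases i with i | i
  · exact map_add (galAct (V := V) s) _ _
  · apply LinearMap.ext
    intro z
    exact map_add s _ _

lemma factorGal_smul (s : K ≃ₐ[k] K) (i : Fin p ⊕ Fin q) (c : K)
    (x : TensorFactor K (K ⊗[k] V) p q i) :
    factorGal s i (c • x) = s c • factorGal s i x := by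
  rcases i with i | i
  · exact galAct_smul (V := V) s _ _
  · apply LinearMap.ext
    intro z
    exact map_mul s _ _

lemma factorGal_symm (s : K ≃ₐ[k] K) (i : Fin p ⊕ Fin q)
    (x : TensorFactor K (K ⊗[k] V) p q i) :
    factorGal s.symm i (factorGal s i x) = x := by
  rcases i with i | i
  · exact galAct_galAct' (V := V) s _
  · apply LinearMap.ext
    intro z
    change s.symm (s ((show Module.Dual K (K ⊗[k] V) from x)
      (galAct s.symm (galAct s.symm.symm z)))) = _
    rw [AlgEquiv.symm_apply_apply, galAct_galAct s.symm]

lemma factorGal_factorBC (s : K ≃ₐ[k] K) (i : Fin p ⊕ Fin q) (m : TensorFactor k V p q i) :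
    factorGal s i (factorBC k K V p q i m) = factorBC k K V p q i m := by
  rcases i with i | i
  · exact (galAct_tmul (V := V) s 1 m).trans (by rw [map_one]; rfl)
  · refine dual_ext' (V := V) fun a v => ?_
    refine (congrArg s (dualBC_tmul (V := V) m (s.symm a) v)).trans ?_
    refine Eq.trans ?_ (dualBC_tmul (V := V) m a v).symm
    simp

lemma factorGal_congr (s : K ≃ₐ[k] K) (f : (K ⊗[k] V) ≃ₗ[K] (K ⊗[k] W)) (i : Fin p ⊕ Fin q)
    (x : TensorFactor K (K ⊗[k] V) p q i) :
    factorGal s i (factorCongr f i x) = factorCongr (galConj s f) i (factorGal s i x) := by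
  rcases i with i | i
  · exact (galConj_galAct s f _).symm
  · apply LinearMap.ext
    intro y
    change s ((show Module.Dual K (K ⊗[k] V) from x) (f.symm (galAct s.symm y))) =
      s ((show Module.Dual K (K ⊗[k] V) from x) (galAct s.symm ((galConj s f).symm y)))
    rw [← galConj_symm, galConj_apply, galAct_galAct']

variable [FiniteDimensional k V]

/-- factor basis over `k` -/
def factorBasis (k V : Type u) [Field k] [AddCommGroup V] [Module k V] [FiniteDimensional k V]
    (p q : ℕ) : ∀ i : Fin p ⊕ Fin q,
    Module.Basis (Fin (Module.finrank k V)) k (TensorFactor k V p q i) := fun i =>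
  match i with
  | Sum.inl _ => Module.finBasis k V
  | Sum.inr _ => (Module.finBasis k V).dualBasis

/-- factor basis over `K` -/
def factorBasisK (k K V : Type u) [Field k] [Field K] [Algebra k K]
    [AddCommGroup V] [Module k V] [FiniteDimensional k V]
    (p q : ℕ) : ∀ i : Fin p ⊕ Fin q,
    Module.Basis (Fin (Module.finrank k V)) K (TensorFactor K (K ⊗[k] V) p q i) := fun i =>
  match i with
  | Sum.inl _ => (Module.finBasis k V).baseChange K
  | Sum.inr _ => ((Module.finBasis k V).baseChange K).dualBasis

lemma factorBC_basis (i : Fin p ⊕ Fin q) (j : Fin (Module.finrank k V)) :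
    factorBC k K V p q i (factorBasis k V p q i j) = factorBasisK k K V p q i j := by
  rcases i with i | i
  · exact (Module.Basis.baseChange_apply (S := K) (Module.finBasis k V) j).symm
  · apply ((Module.finBasis k V).baseChange K).ext
    intro l
    change dualBC k K V ((Module.finBasis k V).dualBasis j) _ =
      ((Module.finBasis k V).baseChange K).dualBasis j _
    rw [Module.Basis.baseChange_apply, dualBC_tmul, ← Module.Basis.baseChange_apply]
    simp [Finsupp.single_apply]

/-- basis of the tensor space over `k` -/
def tsBasis (k V : Type u) [Field k] [AddCommGroup V] [Module k V] [FiniteDimensional k V]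
    (p q : ℕ) : Module.Basis (Fin p ⊕ Fin q → Fin (Module.finrank k V)) k (TensorSpace k V p q) :=
  Basis.piTensorProduct (factorBasis k V p q)

/-- basis of the tensor space over `K` -/
def tsBasisK (k K V : Type u) [Field k] [Field K] [Algebra k K]
    [AddCommGroup V] [Module k V] [FiniteDimensional k V]
    (p q : ℕ) : Module.Basis (Fin p ⊕ Fin q → Fin (Module.finrank k V)) K
      (TensorSpace K (K ⊗[k] V) p q) :=
  Basis.piTensorProduct (factorBasisK k K V p q)

lemma tsBasis_apply (j) : tsBasis k V p q j = tprodT k V p q (fun i => factorBasis k V p q i (j i)) :=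
  Basis.piTensorProduct_apply _ _

lemma tsBasisK_apply (j) : tsBasisK k K V p q j =
    tprodT K (K ⊗[k] V) p q (fun i => factorBasisK k K V p q i (j i)) :=
  Basis.piTensorProduct_apply _ _

lemma tensorBC_basis (j) : tensorBC k K V p q (tsBasis k V p q j) = tsBasisK k K V p q j := by
  rw [tsBasis_apply, tsBasisK_apply, tensorBC_tprod]
  simp only [factorBC_basis]

/-- base change equivalence for tensor spaces -/
def bcEquiv (k K V : Type u) [Field k] [Field K] [Algebra k K]
    [AddCommGroup V] [Module k V] [FiniteDimensional k V]
    (p q : ℕ) : (K ⊗[k] TensorSpace k V p q) ≃ₗ[K] TensorSpace K (K ⊗[k] V) p q :=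
  ((tsBasis k V p q).baseChange K).equiv (tsBasisK k K V p q) (Equiv.refl _)

lemma bcEquiv_tmul (y : TensorSpace k V p q) :
    bcEquiv k K V p q (1 ⊗ₜ y) = tensorBC k K V p q y := by
  have : ((bcEquiv k K V p q).toLinearMap.restrictScalars k) ∘ₗ inclBC k K (TensorSpace k V p q) =
      tensorBC k K V p q := by
    apply (tsBasis k V p q).ext
    intro j
    rw [tensorBC_basis]
    change bcEquiv k K V p q (1 ⊗ₜ tsBasis k V p q j) = _
    rw [← Module.Basis.baseChange_apply, bcEquiv, Module.Basis.equiv_apply]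
    rfl
  exact LinearMap.congr_fun this y

lemma tensorBC_injective : Function.Injective (tensorBC k K V p q) := by
  intro x y h
  rw [← bcEquiv_tmul, ← bcEquiv_tmul] at h
  exact inclBC_injective ((bcEquiv k K V p q).injective h)

/-- Galois action on the tensor space. -/
def tensorGal (s : K ≃ₐ[k] K) (y : TensorSpace K (K ⊗[k] V) p q) : TensorSpace K (K ⊗[k] V) p q :=
  bcEquiv k K V p q (galAct s ((bcEquiv k K V p q).symm y))

lemma tensorGal_add (s : K ≃ₐ[k] K) (x y : TensorSpace K (K ⊗[k] V) p q) :
    tensorGal s (x + y) = tensorGal s x + tensorGal s y := by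
  simp [tensorGal]

lemma tensorGal_smul (s : K ≃ₐ[k] K) (c : K) (x : TensorSpace K (K ⊗[k] V) p q) :
    tensorGal s (c • x) = s c • tensorGal s x := by
  simp [tensorGal, galAct_smul]

lemma tensorGal_tensorBC (s : K ≃ₐ[k] K) (y : TensorSpace k V p q) :
    tensorGal s (tensorBC k K V p q y) = tensorBC k K V p q y := by
  rw [← bcEquiv_tmul, tensorGal, LinearEquiv.symm_apply_apply, galAct_tmul, map_one]

lemma exists_of_tensorGal_fixed [IsGalois k K] [FiniteDimensional k K]
    (y : TensorSpace K (K ⊗[k] V) p q) (h : ∀ s : K ≃ₐ[k] K, tensorGal s y = y) :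
    ∃ z, tensorBC k K V p q z = y := by
  obtain ⟨z, hz⟩ := exists_of_fixed ((bcEquiv k K V p q).symm y) (fun s => by
    apply (bcEquiv k K V p q).injective
    rw [LinearEquiv.apply_symm_apply]
    exact h s)
  exact ⟨z, by rw [← bcEquiv_tmul, ← hz, LinearEquiv.apply_symm_apply]⟩

lemma factorGal_update (s : K ≃ₐ[k] K) [DecidableEq (Fin p ⊕ Fin q)]
    (m : ∀ i, TensorFactor K (K ⊗[k] V) p q i) (i) (x : TensorFactor K (K ⊗[k] V) p q i) :
    (fun j => factorGal s j (Function.update m i x j)) =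
      Function.update (fun j => factorGal s j (m j)) i (factorGal s i x) := by
  funext j
  by_cases h : j = i
  · subst h; simp
  · simp [h]

/-- Auxiliary multilinear map. -/
def galMulti (s : K ≃ₐ[k] K) :
    MultilinearMap K (TensorFactor K (K ⊗[k] V) p q) (TensorSpace K (K ⊗[k] V) p q) where
  toFun m := tensorGal s (tprodT K (K ⊗[k] V) p q (fun i => factorGal s.symm i (m i)))
  map_update_add' m i x y := by
    simp only [factorGal_update, factorGal_add, MultilinearMap.map_update_add, tensorGal_add]
  map_update_smul' m i c x := by
    simp only [factorGal_update, factorGal_smul, MultilinearMap.map_update_smul, tensorGal_smul,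
      AlgEquiv.apply_symm_apply]

lemma galMulti_apply (s : K ≃ₐ[k] K) (m : ∀ i, TensorFactor K (K ⊗[k] V) p q i) :
    galMulti s m = tensorGal s (tprodT K (K ⊗[k] V) p q (fun i => factorGal s.symm i (m i))) := by
  simp only [galMulti, MultilinearMap.coe_mk]

lemma galMulti_eq (s : K ≃ₐ[k] K) : galMulti (V := V) (p := p) (q := q) s = tprodT K _ p q := by
  apply Module.Basis.ext_multilinear (factorBasisK k K V p q)
  intro v
  rw [galMulti_apply]
  simp only [← factorBC_basis, factorGal_factorBC]
  rw [← tensorBC_tprod, tensorGal_tensorBC]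

lemma tensorGal_tprod (s : K ≃ₐ[k] K) (m : ∀ i, TensorFactor K (K ⊗[k] V) p q i) :
    tensorGal s (tprodT K (K ⊗[k] V) p q m) =
      tprodT K (K ⊗[k] V) p q (fun i => factorGal s i (m i)) := by
  have h := galMulti_apply s (fun i => factorGal s i (m i))
  rw [galMulti_eq] at h
  simp only [factorGal_symm] at h
  exact h.symm

lemma tensorGal_congr [FiniteDimensional k W] (s : K ≃ₐ[k] K) (f : (K ⊗[k] V) ≃ₗ[K] (K ⊗[k] W))
    (y : TensorSpace K (K ⊗[k] V) p q) :
    tensorGal s (tensorCongr f y) = tensorCongr (galConj s f) (tensorGal s y) := by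
  induction y using tensor_induction with
  | h1 r m =>
    rw [map_smul, tensorGal_smul, tensorGal_smul, map_smul, tensorCongr_tprod, tensorGal_tprod,
      tensorGal_tprod, tensorCongr_tprod]
    simp only [factorGal_congr]
  | h2 x y hx hy => simp only [map_add, tensorGal_add, hx, hy]

end HelpersC

section HelpersD

variable {k K : Type u} [Field k] [Field K] [Algebra k K]
variable {V : Type u} [AddCommGroup V] [Module k V] [FiniteDimensional k V] {p q : ℕ}

lemma isTensorCocycle_of_iso (x : TensorSpace k V p q) (P : TensorPair k p q)
    (f : (K ⊗[k] V) ≃ₗ[K] (K ⊗[k] P.carrier)) (hf : IsTensorIsoK k K V p q x P f) :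
    IsTensorCocycle k K V p q x (fun s => (galConj s f).trans f.symm) := by
  refine ⟨fun s => ?_, fun s t => ?_⟩
  · rw [tensorCongr_trans]
    apply tensorCongr_symm
    rw [hf]
    conv_rhs => rw [← tensorGal_tensorBC s x, ← tensorGal_congr, hf, tensorGal_tensorBC]
  · simp only [galConj_trans, galConj_mul, galConj_symm]
    ext1 y
    simp [LinearEquiv.mul_apply]

lemma cohomologous_of_kIso (x : TensorSpace k V p q) (P P' : TensorPair k p q)
    (f : (K ⊗[k] V) ≃ₗ[K] (K ⊗[k] P.carrier)) (hf : IsTensorIsoK k K V p q x P f)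
    (f' : (K ⊗[k] V) ≃ₗ[K] (K ⊗[k] P'.carrier)) (hf' : IsTensorIsoK k K V p q x P' f')
    (h : kIsomorphic k P P') :
    TensorCohomologous k K V p q x (fun s => (galConj s f).trans f.symm)
      (fun s => (galConj s f').trans f'.symm) := by
  obtain ⟨e, he⟩ := h
  refine ⟨(f'.trans (eqBC K e).symm).trans f.symm, ?_, fun s => ?_⟩
  · rw [tensorCongr_trans, tensorCongr_trans]
    apply tensorCongr_symm
    rw [hf]
    symm
    apply tensorCongr_symm
    rw [tensorBC_congr, he, hf']
  · rw [mul_assoc, eq_inv_mul_iff_mul_eq]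
    simp only [galConj_trans, galConj_symm, galConj_eqBC]
    ext1 y
    simp [LinearEquiv.mul_apply]

lemma kIso_of_cohomologous [IsGalois k K] [FiniteDimensional k K]
    (x : TensorSpace k V p q) (P P' : TensorPair k p q)
    (f : (K ⊗[k] V) ≃ₗ[K] (K ⊗[k] P.carrier)) (hf : IsTensorIsoK k K V p q x P f)
    (f' : (K ⊗[k] V) ≃ₗ[K] (K ⊗[k] P'.carrier)) (hf' : IsTensorIsoK k K V p q x P' f')
    (h : TensorCohomologous k K V p q x (fun s => (galConj s f).trans f.symm)
      (fun s => (galConj s f').trans f'.symm)) : kIsomorphic k P P' := by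
  obtain ⟨c, hc, h⟩ := h
  obtain ⟨e, he⟩ := exists_eqBC_of_fixed ((f.symm.trans c.symm).trans f') (fun s => by
    have hs := h s
    rw [mul_assoc, eq_inv_mul_iff_mul_eq] at hs
    simp only [galConj_trans, galConj_symm]
    ext1 y
    obtain ⟨z, rfl⟩ := ((galConj s c).trans (galConj s f)).surjective y
    have hz := LinearEquiv.congr_fun hs z
    simp only [LinearEquiv.mul_apply, LinearEquiv.trans_apply] at hz
    simp [← hz])
  refine ⟨e, ?_⟩
  apply tensorBC_injective (K := K)
  rw [← tensorBC_congr, he, tensorCongr_trans, tensorCongr_trans, ← hf']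
  congr 1
  apply tensorCongr_symm
  rw [hc]
  exact (tensorCongr_symm _ _ _ hf).symm

lemma exists_of_cocycle [IsGalois k K] [FiniteDimensional k K]
    (x : TensorSpace k V p q) (a : (K ≃ₐ[k] K) → ((K ⊗[k] V) ≃ₗ[K] (K ⊗[k] V)))
    (ha : IsTensorCocycle k K V p q x a) :
    ∃ (P : TensorPair k p q) (f : (K ⊗[k] V) ≃ₗ[K] (K ⊗[k] P.carrier)),
      IsTensorIsoK k K V p q x P f ∧ (fun s => (galConj s f).trans f.symm) = a := by
  haveI : FiniteDimensional k (DescT a) := inferInstanceAs (FiniteDimensional k (descSpace a))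
  let g : (K ⊗[k] DescT a) ≃ₗ[K] (K ⊗[k] V) := LinearEquiv.ofBijective (descMap a)
    ⟨descMap_injective a, descMap_surjective a ha.2⟩
  have hg : ∀ s, (galConj s g.symm).trans g = a s := by
    intro s
    ext1 y
    obtain ⟨z, rfl⟩ := (galAct s).surjective y
    obtain ⟨w, rfl⟩ := g.surjective z
    rw [LinearEquiv.trans_apply, galConj_galAct, LinearEquiv.symm_apply_apply]
    exact (descMap_equivariant a s w).symm
  obtain ⟨x', hx'⟩ := exists_of_tensorGal_fixed (tensorCongr g.symm (tensorBC k K V p q x))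
    (fun s => by
      rw [tensorGal_congr, tensorGal_tensorBC]
      symm
      apply tensorCongr_symm
      rw [← tensorCongr_trans, hg, ha.1])
  exact ⟨⟨DescT a, x'⟩, g.symm, hx'.symm, funext hg⟩

lemma cohomologous_equivalence (x : TensorSpace k V p q) :
    Equivalence (TensorCohomologous k K V p q x) := by
  have hm : ∀ (s : K ≃ₐ[k] K) (c d : (K ⊗[k] V) ≃ₗ[K] (K ⊗[k] V)),
      galConj s (c * d) = galConj s c * galConj s d := fun s c d => galConj_trans s d c
  have hi : ∀ (s : K ≃ₐ[k] K) (c : (K ⊗[k] V) ≃ₗ[K] (K ⊗[k] V)),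
      galConj s c⁻¹ = (galConj s c)⁻¹ := fun s c => rfl
  have h1 : ∀ (s : K ≃ₐ[k] K), galConj s (1 : (K ⊗[k] V) ≃ₗ[K] (K ⊗[k] V)) = 1 := by
    intro s
    have := hm s 1 1
    rw [one_mul] at this
    exact (left_eq_mul.1 this)
  refine ⟨fun a => ⟨1, tensorCongr_refl _, fun s => ?_⟩, ?_, ?_⟩
  · rw [h1]; simp
  · rintro a b ⟨c, hc, h⟩
    refine ⟨c⁻¹, tensorCongr_symm _ _ _ hc, fun s => ?_⟩
    rw [h, hi]
    group
  · rintro a b d ⟨c, hc, h⟩ ⟨c', hc', h'⟩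
    refine ⟨c * c', ?_, fun s => ?_⟩
    · exact (tensorCongr_trans c' c _).trans (by rw [hc', hc])
    · rw [h', h, hm]
      group

end HelpersD

section Statement

variable (k K : Type u) [Field k] [Field K] [Algebra k K] [IsGalois k K]
  [FiniteDimensional k K]

variable {V : Type u} [AddCommGroup V] [Module k V] [FiniteDimensional k V]
variable {p q : ℕ}

/-- **Serre, Theorem 3.1 of the paper.**  Let `K/k` be a finite Galois
extension with Galois group `G`, `V` a finite-dimensional `k`-vector space
and `x` a tensor of type `(p, q)` on `V`.  Let `A_K` be the group of
`K`-automorphisms of `V_K` fixing `x_K`, with `G` acting by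
`f ↦ s(f) = s ∘ f ∘ s⁻¹`.  Then the map
`θ : E_{V,x}(K/k) → H¹(G, A_K)`, sending the class of `(V', x')` to the
class of the 1-cocycle `s ↦ f⁻¹ ∘ s(f)` for any `K`-isomorphism
`f : (V_K, x_K) → (V'_K, x'_K)`, is well defined and bijective. -/
theorem tensor_galois_descent (x : TensorSpace k V p q) :
    ∃ θ : TensorClasses k K V p q x → TensorH1 k K V p q x,
      Function.Bijective θ ∧
      ∀ (P : TensorPair k p q) (hP : BecomesIsomorphic k K V p q x P)
        (f : (K ⊗[k] V) ≃ₗ[K] (K ⊗[k] P.carrier))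
        (_ : IsTensorIsoK k K V p q x P f),
        ∃ hcoc : IsTensorCocycle k K V p q x (fun s => (galConj s f).trans f.symm),
          θ (Quot.mk _ ⟨P, hP⟩) =
            Quot.mk _ ⟨fun s => (galConj s f).trans f.symm, hcoc⟩ := by
  classical
  have key : ∀ (P P' : TensorPair k p q)
      (f : (K ⊗[k] V) ≃ₗ[K] (K ⊗[k] P.carrier)) (hf : IsTensorIsoK k K V p q x P f)
      (f' : (K ⊗[k] V) ≃ₗ[K] (K ⊗[k] P'.carrier)) (hf' : IsTensorIsoK k K V p q x P' f')
      (_ : kIsomorphic k P P'),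
      (Quot.mk _ ⟨_, isTensorCocycle_of_iso x P f hf⟩ : TensorH1 k K V p q x) =
        Quot.mk _ ⟨_, isTensorCocycle_of_iso x P' f' hf'⟩ := by
    intro P P' f hf f' hf' h
    exact Quot.sound (cohomologous_of_kIso x P P' f hf f' hf' h)
  have hrefl : ∀ P : TensorPair k p q, kIsomorphic k P P := fun P =>
    ⟨LinearEquiv.refl k _, tensorCongr_refl _⟩
  let θ : TensorClasses k K V p q x → TensorH1 k K V p q x :=
    Quot.lift (fun P => Quot.mk _ ⟨_, isTensorCocycle_of_iso x P.1 P.2.choose P.2.choose_spec⟩)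
      (fun P P' h => key P.1 P'.1 _ P.2.choose_spec _ P'.2.choose_spec h)
  have hθ : ∀ (P : TensorPair k p q) (hP : BecomesIsomorphic k K V p q x P)
      (f : (K ⊗[k] V) ≃ₗ[K] (K ⊗[k] P.carrier)) (hf : IsTensorIsoK k K V p q x P f),
      θ (Quot.mk _ ⟨P, hP⟩) = Quot.mk _ ⟨_, isTensorCocycle_of_iso x P f hf⟩ :=
    fun P hP f hf => key P P _ hP.choose_spec f hf (hrefl P)
  refine ⟨θ, ⟨?_, ?_⟩, fun P hP f hf => ⟨isTensorCocycle_of_iso x P f hf, hθ P hP f hf⟩⟩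
  · rintro ⟨P, f, hf⟩ ⟨P', f', hf'⟩ h
    have h1 := (hθ P ⟨f, hf⟩ f hf).symm.trans (h.trans (hθ P' ⟨f', hf'⟩ f' hf'))
    have hE : Equivalence (fun a b : {a : (K ≃ₐ[k] K) → ((K ⊗[k] V) ≃ₗ[K] (K ⊗[k] V)) //
        IsTensorCocycle k K V p q x a} => TensorCohomologous k K V p q x a.1 b.1) :=
      (cohomologous_equivalence x).comap Subtype.val
    have h2 := (hE.quot_mk_eq_iff _ _).1 h1
    exact Quot.sound (kIso_of_cohomologous x P P' f hf f' hf' h2)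
  · rintro ⟨a, ha⟩
    obtain ⟨P, f, hf, rfl⟩ := exists_of_cocycle x a ha
    exact ⟨Quot.mk _ ⟨P, f, hf⟩, hθ P ⟨f, hf⟩ f hf⟩

end Statement
end
end

section
/- Existence and uniqueness of the monodromy weight filtration: let V be a finite-dimensional vector space over a field of characteristic zero and let N : V → V be a nilpotent linear endomorphism. Then there exists a unique increasing filtration of subspaces ... ⊆ W_{i-1} ⊆ W_i ⊆ ... of V indexed by ℤ, with W_i = 0 for i sufficiently small and W_i = V for i sufficiently large, such that (i) N(W_i) ⊆ W_{i-2} for all i, and (ii) for every k ≥ 0 the map induced by N^k on graded pieces, Gr_k V = W_k/W_{k-1} → W_{-k}/W_{-k-1} = Gr_{-k} V, is an isomorphism (hard Lefschetz property). -/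
section MWF
variable {K V : Type*} [Field K] [AddCommGroup V] [Module K V]

theorem mwf_pow (N : Module.End K V) (W : ℤ → Submodule K V)
    (h : ∀ i : ℤ, (W i).map N ≤ W (i - 2)) (k : ℕ) :
    ∀ (i : ℤ) (x : V), x ∈ W i → (N ^ k) x ∈ W (i - 2 * k) := by
  induction k with
  | zero => intro i x hx; simpa using hx
  | succ k ih =>
    intro i x hx
    have h1 := h _ (Submodule.mem_map_of_mem (ih i x hx))
    rw [pow_succ', Module.End.mul_apply]
    convert h1 using 2
    push_cast; ring

theorem mwf_mono (W : ℤ → Submodule K V) (h : ∀ i : ℤ, W (i - 1) ≤ W i) : Monotone W := by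
  apply monotone_int_of_le_succ
  intro n
  simpa using h (n + 1)

theorem mwf_A (N : Module.End K V) (W : ℤ → Submodule K V) (hm : Monotone W)
    (hb : ∃ b : ℤ, ∀ i : ℤ, b ≤ i → W i = ⊤)
    (hN : ∀ i : ℤ, (W i).map N ≤ W (i - 2))
    (hi : ∀ k : ℕ, ∀ x : V, x ∈ W (k : ℤ) → (N ^ k) x ∈ W (-(k : ℤ) - 1) → x ∈ W ((k : ℤ) - 1))
    (k : ℕ) (x : V) (hx : (N ^ k) x ∈ W (-(k : ℤ) - 1)) : x ∈ W ((k : ℤ) - 1) := by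
  obtain ⟨b, hb⟩ := hb
  have key : ∀ n : ℕ, x ∈ W ((k : ℤ) - 1 + n) → x ∈ W ((k : ℤ) - 1) := by
    intro n
    induction n with
    | zero => intro h; simpa using h
    | succ n ih =>
      intro h
      apply ih
      have h1 := hi (k + n) x (by convert h using 2; push_cast; ring) (by
        have := mwf_pow N W hN n _ _ hx
        rw [← Module.End.mul_apply, ← pow_add, add_comm n k] at this
        exact hm (by push_cast; omega) this)
      convert h1 using 2; push_cast; ring
  apply key (b - (k - 1)).toNat
  rw [hb _ (by omega)]; trivial

theorem mwf_B (N : Module.End K V) (W : ℤ → Submodule K V) (hm : Monotone W)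
    (ha : ∃ a : ℤ, ∀ i : ℤ, i ≤ a → W i = ⊥)
    (hN : ∀ i : ℤ, (W i).map N ≤ W (i - 2))
    (hs : ∀ k : ℕ, ∀ y : V, y ∈ W (-(k : ℤ)) →
          ∃ x : V, x ∈ W (k : ℤ) ∧ y - (N ^ k) x ∈ W (-(k : ℤ) - 1))
    (k : ℕ) : W (-(k : ℤ)) = (W k).map (N ^ k) := by
  obtain ⟨a, ha⟩ := ha
  apply le_antisymm
  · have key : ∀ n k : ℕ, -(k : ℤ) ≤ a + n → W (-(k : ℤ)) ≤ (W k).map (N ^ k) := by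
      intro n
      induction n with
      | zero => intro k h; rw [ha _ (by simpa using h)]; exact bot_le
      | succ n ih =>
        intro k h y hy
        obtain ⟨x, hx, hxy⟩ := hs k y hy
        obtain ⟨z, hz, hzy⟩ := ih (k + 1) (by push_cast at *; omega)
          (show y - (N ^ k) x ∈ _ by convert hxy using 2; push_cast; ring)
        have hz' : N z ∈ W k := by
          have h1 := hN _ (Submodule.mem_map_of_mem hz)
          exact hm (by push_cast; omega) h1
        refine ⟨x + N z, Submodule.add_mem _ hx hz', ?_⟩
        rw [pow_succ, Module.End.mul_apply] at hzy
        rw [map_add, hzy]; abel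
    exact key (-(k : ℤ) - a).toNat k (by omega)
  · rintro _ ⟨x, hx, rfl⟩
    have := mwf_pow N W hN k _ _ hx
    convert this using 2; ring

theorem mwf_AB (N : Module.End K V) (W : ℤ → Submodule K V) (hm : Monotone W)
    (ha : ∃ a : ℤ, ∀ i : ℤ, i ≤ a → W i = ⊥)
    (hb : ∃ b : ℤ, ∀ i : ℤ, b ≤ i → W i = ⊤)
    (hN : ∀ i : ℤ, (W i).map N ≤ W (i - 2))
    (hi : ∀ k : ℕ, ∀ x : V, x ∈ W (k : ℤ) → (N ^ k) x ∈ W (-(k : ℤ) - 1) → x ∈ W ((k : ℤ) - 1))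
    (hs : ∀ k : ℕ, ∀ y : V, y ∈ W (-(k : ℤ)) →
          ∃ x : V, x ∈ W (k : ℤ) ∧ y - (N ^ k) x ∈ W (-(k : ℤ) - 1))
    (k : ℕ) : W ((k : ℤ) - 1) = ((W (k + 1)).map (N ^ (k + 1))).comap (N ^ k) := by
  have e : W (-(k : ℤ) - 1) = (W (k + 1)).map (N ^ (k + 1)) := by
    have := mwf_B N W hm ha hN hs (k + 1)
    push_cast at this
    rw [← this]; congr 1; ring
  rw [← e]
  apply le_antisymm
  · intro x hx
    have := mwf_pow N W hN k _ _ hx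
    rw [Submodule.mem_comap]
    convert this using 2; ring
  · intro x hx
    exact mwf_A N W hm hb hN hi k x hx

theorem mwf_unique (N : Module.End K V) (W W' : ℤ → Submodule K V)
    (hb : ∃ b : ℤ, ∀ i : ℤ, b ≤ i → W i = ⊤)
    (hb' : ∃ b : ℤ, ∀ i : ℤ, b ≤ i → W' i = ⊤)
    (hA : ∀ k : ℕ, W ((k : ℤ) - 1) = ((W (k + 1)).map (N ^ (k + 1))).comap (N ^ k))
    (hA' : ∀ k : ℕ, W' ((k : ℤ) - 1) = ((W' (k + 1)).map (N ^ (k + 1))).comap (N ^ k))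
    (hB : ∀ k : ℕ, W (-(k : ℤ)) = (W k).map (N ^ k))
    (hB' : ∀ k : ℕ, W' (-(k : ℤ)) = (W' k).map (N ^ k)) : W = W' := by
  obtain ⟨b, hb⟩ := hb
  obtain ⟨c, hc⟩ := hb'
  have key : ∀ n k : ℕ, max b c ≤ (k : ℤ) - 1 + n → W ((k : ℤ) - 1) = W' ((k : ℤ) - 1) := by
    intro n
    induction n with
    | zero => intro k h; rw [hb _ (by simp at h; omega), hc _ (by simp at h; omega)]
    | succ n ih =>
      intro k h
      have := ih (k + 2) (by push_cast at *; omega)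
      have e : (((k + 2 : ℕ) : ℤ) - 1) = k + 1 := by push_cast; ring
      rw [e] at this
      rw [hA, hA', this]
  have pos : ∀ k : ℕ, W k = W' k := by
    intro k
    have := key (max b c - k).toNat (k + 1) (by push_cast; omega)
    simpa using this
  funext i
  obtain ⟨k, rfl | rfl⟩ := i.eq_nat_or_neg
  · exact pos k
  · rw [hB, hB', pos]

/-- The explicit filtration. -/
def mwfW (N : Module.End K V) (k : ℤ) : Submodule K V :=
  ⨆ j : ℕ, (LinearMap.ker (N ^ (k + 2 * j + 1).toNat)).map (N ^ j)

theorem mwf_ker_mono (N : Module.End K V) {m n : ℕ} (h : m ≤ n) :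
    LinearMap.ker (N ^ m) ≤ LinearMap.ker (N ^ n) := by
  intro x hx
  rw [LinearMap.mem_ker] at *
  obtain ⟨c, rfl⟩ := Nat.exists_eq_add_of_le' h
  rw [pow_add, Module.End.mul_apply, hx, map_zero]

theorem mwfW_map (N : Module.End K V) (i : ℤ) : (mwfW N i).map N ≤ mwfW N (i - 2) := by
  unfold mwfW
  rw [Submodule.map_iSup]
  refine iSup_le fun j => ?_
  refine le_trans ?_ (le_iSup _ (j + 1))
  rw [← Submodule.map_comp, ← Module.End.mul_eq_comp, ← pow_succ']
  have : i - 2 + 2 * ((j + 1 : ℕ) : ℤ) + 1 = i + 2 * j + 1 := by push_cast; ring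
  rw [this]

theorem mwfW_neg (N : Module.End K V) (k : ℕ) :
    mwfW N (-(k : ℤ)) ≤ (mwfW N k).map (N ^ k) := by
  unfold mwfW
  rw [Submodule.map_iSup]
  refine iSup_le fun j => ?_
  by_cases h : j < k
  · rintro _ ⟨x, hx, rfl⟩
    have := mwf_ker_mono N (n := j) (by omega) hx
    rw [LinearMap.mem_ker] at this
    rw [this]; exact Submodule.zero_mem _
  · obtain ⟨i, rfl⟩ := Nat.exists_eq_add_of_le (not_lt.1 h)
    refine le_trans ?_ (le_iSup _ i)
    rw [← Submodule.map_comp, ← Module.End.mul_eq_comp, ← pow_add]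
    have : -(k : ℤ) + 2 * ((k + i : ℕ) : ℤ) + 1 = k + 2 * i + 1 := by push_cast; ring
    rw [this]

theorem mwfW_le (N : Module.End K V) (i : ℤ) : mwfW N (i - 1) ≤ mwfW N i :=
  iSup_mono fun _ => Submodule.map_mono (mwf_ker_mono N (by omega))

theorem mwfW_inj (N : Module.End K V) (k : ℕ) (x : V)
    (hx : (N ^ k) x ∈ mwfW N (-(k : ℤ) - 1)) : x ∈ mwfW N ((k : ℤ) - 1) := by
  have e : -(k : ℤ) - 1 = -((k + 1 : ℕ) : ℤ) := by push_cast; ring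
  rw [e] at hx
  obtain ⟨z, hz, hzx⟩ := mwfW_neg N (k + 1) hx
  have h1 : N z ∈ mwfW N ((k : ℤ) - 1) := by
    have := mwfW_map N _ (Submodule.mem_map_of_mem hz)
    have e : ((k + 1 : ℕ) : ℤ) - 2 = k - 1 := by push_cast; ring
    rwa [e] at this
  have h2 : x - N z ∈ mwfW N ((k : ℤ) - 1) := by
    refine (le_iSup (fun j : ℕ => (LinearMap.ker (N ^ ((k : ℤ) - 1 + 2 * j + 1).toNat)).map (N ^ j)) 0) ?_
    refine ⟨x - N z, ?_, by simp⟩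
    have e : ((k : ℤ) - 1 + 2 * ((0 : ℕ) : ℤ) + 1).toNat = k := by simp
    rw [e]
    rw [pow_succ, Module.End.mul_apply] at hzx
    simp [hzx]
  have := Submodule.add_mem _ h2 h1
  simpa using this

theorem mwfW_bot (N : Module.End K V) (d : ℕ) (hd : N ^ d = 0) (i : ℤ) (hi : i ≤ -(d : ℤ)) :
    mwfW N i = ⊥ := by
  rw [eq_bot_iff]
  refine iSup_le fun j => ?_
  rintro _ ⟨x, hx, rfl⟩
  by_cases h : d ≤ j
  · rw [pow_eq_zero_of_le h hd]; simp
  · have := mwf_ker_mono N (n := j) (by omega) hx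
    exact this

theorem mwfW_top (N : Module.End K V) (d : ℕ) (hd : N ^ d = 0) (i : ℤ) (hi : (d : ℤ) ≤ i) :
    mwfW N i = ⊤ := by
  rw [eq_top_iff]
  refine le_trans ?_ (le_iSup _ 0)
  intro x _
  refine ⟨x, ?_, by simp⟩
  have : N ^ (i + 2 * ((0 : ℕ) : ℤ) + 1).toNat = 0 := pow_eq_zero_of_le (by omega) hd
  rw [this]; simp

end MWF

/-- Existence and uniqueness of the monodromy weight filtration of a nilpotent
endomorphism `N` of a finite-dimensional vector space over a field of
characteristic zero: there is a unique increasing filtration `W : ℤ → Submodule`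
which is exhaustive and separated, satisfies `N (W i) ⊆ W (i - 2)`, and such
that for every `k ≥ 0` the map induced by `N ^ k` on the graded pieces
`W k / W (k-1) → W (-k) / W (-k-1)` is an isomorphism (expressed below by the
injectivity and surjectivity of the induced map). -/
theorem monodromy_weight_filtration_existence_uniqueness
    (𝕜 V : Type*) [Field 𝕜] [CharZero 𝕜] [AddCommGroup V] [Module 𝕜 V]
    [FiniteDimensional 𝕜 V] (N : Module.End 𝕜 V) (hN : IsNilpotent N) :
    ∃! W : ℤ → Submodule 𝕜 V,
      -- increasing filtration
      (∀ i : ℤ, W (i - 1) ≤ W i) ∧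
      -- `W i = 0` for `i` sufficiently small
      (∃ a : ℤ, ∀ i : ℤ, i ≤ a → W i = ⊥) ∧
      -- `W i = V` for `i` sufficiently large
      (∃ b : ℤ, ∀ i : ℤ, b ≤ i → W i = ⊤) ∧
      -- (i) `N (W i) ⊆ W (i - 2)`
      (∀ i : ℤ, (W i).map N ≤ W (i - 2)) ∧
      -- (ii) hard Lefschetz: `N ^ k` induces an isomorphism
      -- `W k / W (k-1) ≃ W (-k) / W (-k-1)` for every `k ≥ 0`
      (∀ k : ℕ,
        -- injectivity of the induced map on graded pieces
        (∀ x : V, x ∈ W (k : ℤ) → (N ^ k) x ∈ W (-(k : ℤ) - 1) →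
          x ∈ W ((k : ℤ) - 1)) ∧
        -- surjectivity of the induced map on graded pieces
        (∀ y : V, y ∈ W (-(k : ℤ)) →
          ∃ x : V, x ∈ W (k : ℤ) ∧ y - (N ^ k) x ∈ W (-(k : ℤ) - 1))) := by
  obtain ⟨d, hd⟩ := hN
  refine ⟨mwfW N, ⟨mwfW_le N, ⟨-d, fun i hi => mwfW_bot N d hd i hi⟩,
    ⟨d, fun i hi => mwfW_top N d hd i hi⟩, mwfW_map N, fun k => ⟨?_, ?_⟩⟩, ?_⟩
  · exact fun x _ hx => mwfW_inj N k x hx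
  · intro y hy
    obtain ⟨x, hx, rfl⟩ := mwfW_neg N k hy
    exact ⟨x, hx, by simp⟩
  · rintro W ⟨h1, ha, hb, h4, h5⟩
    have hm := mwf_mono W h1
    have hm' := mwf_mono _ (mwfW_le N)
    have ha' : ∃ a : ℤ, ∀ i : ℤ, i ≤ a → mwfW N i = ⊥ := ⟨-d, fun i hi => mwfW_bot N d hd i hi⟩
    have hb' : ∃ b : ℤ, ∀ i : ℤ, b ≤ i → mwfW N i = ⊤ := ⟨d, fun i hi => mwfW_top N d hd i hi⟩
    have hs' : ∀ k : ℕ, ∀ y : V, y ∈ mwfW N (-(k : ℤ)) →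
          ∃ x : V, x ∈ mwfW N (k : ℤ) ∧ y - (N ^ k) x ∈ mwfW N (-(k : ℤ) - 1) := by
      intro k y hy
      obtain ⟨x, hx, rfl⟩ := mwfW_neg N k hy
      exact ⟨x, hx, by simp⟩
    exact mwf_unique N W (mwfW N) hb hb'
      (mwf_AB N W hm ha hb h4 (fun k => (h5 k).1) (fun k => (h5 k).2))
      (mwf_AB N _ hm' ha' hb' (mwfW_map N) (fun k x _ hx => mwfW_inj N k x hx) hs')
      (mwf_B N W hm ha h4 (fun k => (h5 k).2))
      (mwf_B N _ hm' ha' (mwfW_map N) hs')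
end
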